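/- There exists κ ∈ (0, 1) such that for all a, ε > 0 with a·ε < κ and every n ∈ ℕ the following hold, where x⁺_{ε,m} := 2m/3 + (−1)^{m+1}·(2/(3π))·arcsin(aε) and x⁻_{ε,m} := 2m − (−1)^{m+1}·(2/π)·arcsin(aε) denote the fold points on the layer boundaries: (i) the solution v of ε·v′(x) = −a·ε·v(x) − sin(3πx/2) with v(x⁺_{ε,2n+1}) = 1 satisfies min{x > x⁺_{ε,2n+1} : v(x) = 1} ∈ (x⁺_{ε,2n+2}, x⁺_{ε,2n+3}); (ii) the solution v of ε·v′(x) = −a·ε·v(x) − sin(πx/2) with v(x⁻_{ε,2n}) = −1 satisfies min{x > x⁻_{ε,2n} : v(x) = −1} ∈ (x⁻_{ε,2n+1}, x⁻_{ε,2n+2}). -/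

import Mathlib

open Real Set

/-- Fold points on the upper layer boundary `v = 1`:
`x⁺_{ε,m} = 2m/3 + (−1)^{m+1}·(2/(3π))·arcsin(aε)`. -/
noncomputable def foldP (a ε : ℝ) (m : ℕ) : ℝ :=
  2 * m / 3 + (-1 : ℝ) ^ (m + 1) * (2 / (3 * π)) * Real.arcsin (a * ε)

/-- Fold points on the lower layer boundary `v = −1`:
`x⁻_{ε,m} = 2m − (−1)^{m+1}·(2/π)·arcsin(aε)`. -/
noncomputable def foldM (a ε : ℝ) (m : ℕ) : ℝ :=
  2 * m - (-1 : ℝ) ^ (m + 1) * (2 / π) * Real.arcsin (a * ε)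

lemma sin_lt_sin_of_mem_Ioo_pi_sub {α θ : ℝ} (hα : 0 ≤ α) (hθ : θ ∈ Ioo α (π - α)) :
    Real.sin α < Real.sin θ := by
  obtain ⟨h1, h2⟩ := hθ
  rcases le_total θ (π / 2) with h | h
  · exact Real.sin_lt_sin_of_lt_of_le_pi_div_two (by linarith [pi_pos]) h h1
  · rw [← Real.sin_pi_sub θ]
    exact Real.sin_lt_sin_of_lt_of_le_pi_div_two (by linarith [pi_pos]) (by linarith) (by linarith)

/-- The derivative of `u - 1` multiplied by the integrating factor `exp (a x)`. -/
lemma hasDerivAt_exp_mul_sub_one {a ε W c : ℝ} (hε : ε ≠ 0) {u : ℝ → ℝ} {x : ℝ}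
    (hu : HasDerivAt u ((Real.sin (W * x - c) - a * ε * u x) / ε) x) :
    HasDerivAt (fun y => Real.exp (a * y) * (u y - 1))
      (Real.exp (a * x) * ((Real.sin (W * x - c) - a * ε) / ε)) x := by
  have he : HasDerivAt (fun y => Real.exp (a * y)) (Real.exp (a * x) * (a * 1)) x :=
    ((hasDerivAt_id x).const_mul a).exp
  refine (he.mul (hu.sub_const 1)).congr_deriv ?_
  field_simp
  ring

/-- An antiderivative of the forcing term multiplied by the integrating factor `exp (a x)`. -/
lemma hasDerivAt_exp_mul_forced_response {a ε W c : ℝ} (hε : ε ≠ 0) (hW : 0 < W) (x : ℝ) :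
    HasDerivAt (fun y => Real.exp (a * y) *
        ((a * Real.sin (W * y - c) - W * Real.cos (W * y - c)) / (ε * (a ^ 2 + W ^ 2)) - 1))
      (Real.exp (a * x) * ((Real.sin (W * x - c) - a * ε) / ε)) x := by
  have he : HasDerivAt (fun y => Real.exp (a * y)) (Real.exp (a * x) * (a * 1)) x :=
    ((hasDerivAt_id x).const_mul a).exp
  have hφ : HasDerivAt (fun y => W * y - c) (W * 1) x :=
    ((hasDerivAt_id x).const_mul W).sub_const c
  have hne : a ^ 2 + W ^ 2 ≠ 0 := by positivity
  refine (he.mul ((((hφ.sin.const_mul a).sub (hφ.cos.const_mul W)).div_const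
    (ε * (a ^ 2 + W ^ 2))).sub_const 1)).congr_deriv ?_
  simp only [Pi.sub_apply]
  field_simp
  ring

/-- A solution of `ε u' = sin (W x - c) - a ε u` leaving the level `1` at phase
`arcsin (a ε)` first returns to it at a phase between `π - arcsin (a ε)` and
`2 π + arcsin (a ε)`. -/
lemma exists_isLeast_return {a ε W c x₀ x₁ x₂ : ℝ} (ha : 0 < a) (hε : 0 < ε) (hW : 0 < W)
    (haε : a * ε < 1) {u : ℝ → ℝ}
    (hu : ∀ x, HasDerivAt u ((Real.sin (W * x - c) - a * ε * u x) / ε) x)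
    (h₀ : W * x₀ - c = Real.arcsin (a * ε)) (h₁ : W * x₁ - c = π - Real.arcsin (a * ε))
    (h₂ : W * x₂ - c = Real.arcsin (a * ε) + 2 * π) (hu₀ : u x₀ = 1) :
    ∃ r, IsLeast {x | x₀ < x ∧ u x = 1} r ∧ r ∈ Ioo x₁ x₂ := by
  have hδ : 0 < a * ε := mul_pos ha hε
  set α := Real.arcsin (a * ε) with hα
  have hsin : Real.sin α = a * ε := Real.sin_arcsin (by linarith) haε.le
  have hα0 : 0 < α := Real.arcsin_pos.2 hδ
  have hα1 : α < π / 2 := Real.arcsin_lt_pi_div_two.2 haε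
  have hcos : 0 < Real.cos α := Real.cos_pos_of_mem_Ioo ⟨by linarith, hα1⟩
  have h01 : x₀ < x₁ := lt_of_mul_lt_mul_left (by linarith : W * x₀ < W * x₁) hW.le
  have h12 : x₁ < x₂ := lt_of_mul_lt_mul_left (by linarith : W * x₁ < W * x₂) hW.le
  have hcont : Continuous u := continuous_iff_continuousAt.2 fun x => (hu x).continuousAt
  have hg := fun x => hasDerivAt_exp_mul_sub_one hε.ne' (hu x)
  have hmono : StrictMonoOn (fun y => Real.exp (a * y) * (u y - 1)) (Icc x₀ x₁) := by
    refine strictMonoOn_of_deriv_pos (convex_Icc _ _)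
      (fun x _ => (hg x).continuousAt.continuousWithinAt) fun x hx => ?_
    rw [interior_Icc] at hx
    have hθ0 := mul_lt_mul_of_pos_left hx.1 hW
    have hθ1 := mul_lt_mul_of_pos_left hx.2 hW
    have hlt := sin_lt_sin_of_mem_Ioo_pi_sub hα0.le
      (θ := W * x - c) ⟨by linarith, by linarith⟩
    rw [(hg x).deriv]
    exact mul_pos (Real.exp_pos _) (div_pos (by linarith) hε)
  have habove : ∀ x, x₀ < x → x ≤ x₁ → 1 < u x := by
    intro x hx hx'
    have h := hmono ⟨le_rfl, h01.le⟩ ⟨hx.le, hx'⟩ hx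
    simp only [hu₀, sub_self, mul_zero] at h
    linarith [(mul_pos_iff_of_pos_left (Real.exp_pos _)).1 h]
  have hbelow : u x₂ < 1 := by
    have hd := fun x => (hg x).sub (hasDerivAt_exp_mul_forced_response (a := a) (c := c) hε.ne' hW x)
    have hconst := is_const_of_deriv_eq_zero (fun x => (hd x).differentiableAt)
      (fun x => by rw [(hd x).deriv, sub_self]) x₂ x₀
    simp only [Pi.sub_apply, h₀, h₂, Real.sin_add_two_pi, Real.cos_add_two_pi, hu₀, hsin] at hconst
    have hexp : Real.exp (a * x₀) < Real.exp (a * x₂) :=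
      Real.exp_lt_exp.2 (mul_lt_mul_of_pos_left (h01.trans h12) ha)
    have hneg : (a * (a * ε) - W * Real.cos α) / (ε * (a ^ 2 + W ^ 2)) - 1 < 0 := by
      rw [sub_neg, div_lt_one (by positivity)]
      nlinarith [mul_pos hW hcos, mul_pos hε (pow_pos hW 2)]
    have hprod := mul_neg_of_pos_of_neg (sub_pos.2 hexp) hneg
    have : Real.exp (a * x₂) * (u x₂ - 1) < 0 := by linarith
    linarith [neg_of_mul_neg_right this (Real.exp_pos _).le]
  have hne : (Icc x₁ x₂ ∩ u ⁻¹' {1}).Nonempty := by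
    obtain ⟨x, hx, hx'⟩ := intermediate_value_Icc' h12.le hcont.continuousOn
      ⟨hbelow.le, (habove x₁ h01 le_rfl).le⟩
    exact ⟨x, hx, hx'⟩
  obtain ⟨r, ⟨hr, hr1⟩, hleast⟩ :=
    (isCompact_Icc.inter_right (isClosed_singleton.preimage hcont)).exists_isLeast hne
  have hr1 : u r = 1 := hr1
  have hx1r : x₁ < r := hr.1.lt_of_ne fun h => (habove x₁ h01 le_rfl).ne' (h ▸ hr1)
  have hrx2 : r < x₂ := hr.2.lt_of_ne fun h => hbelow.ne (h ▸ hr1)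
  refine ⟨r, ⟨⟨h01.trans hx1r, hr1⟩, fun x hx => ?_⟩, hx1r, hrx2⟩
  rcases le_or_gt x x₁ with h | h
  · exact absurd hx.2 (habove x hx.1 h).ne'
  · rcases le_total x x₂ with h' | h'
    · exact hleast ⟨⟨h.le, h'⟩, hx.2⟩
    · exact hrx2.le.trans h'

/-- first return to the layer boundary of an excursion leaving
a fold point. There is `κ ∈ (0,1)` such that for all `a, ε > 0` with
`aε < κ` and all `n ∈ ℕ`: (i) the solution of
`ε·v′ = −aεv − sin(3πx/2)` through `(x⁺_{ε,2n+1}, 1)` first returns to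
`v = 1` inside `(x⁺_{ε,2n+2}, x⁺_{ε,2n+3})`; (ii) the solution of
`ε·v′ = −aεv − sin(πx/2)` through `(x⁻_{ε,2n}, −1)` first returns to
`v = −1` inside `(x⁻_{ε,2n+1}, x⁻_{ε,2n+2})`. -/
theorem fold_point_excursion_return :
    ∃ κ ∈ Set.Ioo (0 : ℝ) 1, ∀ a ε : ℝ, 0 < a → 0 < ε → a * ε < κ → ∀ n : ℕ,
      (∀ v : ℝ → ℝ,
        (∀ x : ℝ, HasDerivAt v ((-(a * ε * v x) - Real.sin (3 * π * x / 2)) / ε) x) →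
        v (foldP a ε (2 * n + 1)) = 1 →
        ∃ r : ℝ, IsLeast {x : ℝ | foldP a ε (2 * n + 1) < x ∧ v x = 1} r ∧
          r ∈ Set.Ioo (foldP a ε (2 * n + 2)) (foldP a ε (2 * n + 3))) ∧
      (∀ v : ℝ → ℝ,
        (∀ x : ℝ, HasDerivAt v ((-(a * ε * v x) - Real.sin (π * x / 2)) / ε) x) →
        v (foldM a ε (2 * n)) = -1 →
        ∃ r : ℝ, IsLeast {x : ℝ | foldM a ε (2 * n) < x ∧ v x = -1} r ∧
          r ∈ Set.Ioo (foldM a ε (2 * n + 1)) (foldM a ε (2 * n + 2))) := by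
  refine ⟨1 / 2, by norm_num, fun a ε ha hε haε n => ⟨fun v hv hv₀ => ?_, fun v hv hv₀ => ?_⟩⟩
  · have hπ := pi_ne_zero
    have e₁ : (-1 : ℝ) ^ (2 * n + 1 + 1) = 1 := Even.neg_one_pow ⟨n + 1, by ring⟩
    have e₂ : (-1 : ℝ) ^ (2 * n + 2 + 1) = -1 := Odd.neg_one_pow ⟨n + 1, by ring⟩
    have e₃ : (-1 : ℝ) ^ (2 * n + 3 + 1) = 1 := Even.neg_one_pow ⟨n + 2, by ring⟩
    refine exists_isLeast_return (W := 3 * π / 2) (c := n * (2 * π) + π) ha hε (by positivity)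
      (by linarith) (fun x => ?_) ?_ ?_ ?_ hv₀
    · convert hv x using 2
      rw [← sub_sub, Real.sin_sub_pi, Real.sin_sub_nat_mul_two_pi,
        show 3 * π / 2 * x = 3 * π * x / 2 by ring]
      ring
    · rw [foldP, e₁]; push_cast; field_simp; ring
    · rw [foldP, e₂]; push_cast; field_simp; ring
    · rw [foldP, e₃]; push_cast; field_simp; ring
  · have hπ := pi_ne_zero
    have e₀ : (-1 : ℝ) ^ (2 * n + 1) = -1 := Odd.neg_one_pow ⟨n, rfl⟩
    have e₁ : (-1 : ℝ) ^ (2 * n + 1 + 1) = 1 := Even.neg_one_pow ⟨n + 1, by ring⟩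
    have e₂ : (-1 : ℝ) ^ (2 * n + 2 + 1) = -1 := Odd.neg_one_pow ⟨n + 1, by ring⟩
    have h := exists_isLeast_return (W := π / 2) (c := n * (2 * π)) (u := fun x => -v x)
      (x₀ := foldM a ε (2 * n)) (x₁ := foldM a ε (2 * n + 1)) (x₂ := foldM a ε (2 * n + 2))
      ha hε (by positivity) (by linarith) (fun x => ?_) ?_ ?_ ?_ (by simp [hv₀])
    · simpa only [neg_eq_iff_eq_neg] using h
    · refine (hv x).neg.congr_deriv ?_
      rw [Real.sin_sub_nat_mul_two_pi, show π / 2 * x = π * x / 2 by ring]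
      ring
    · rw [foldM, e₀]; push_cast; field_simp; ring
    · rw [foldM, e₁]; push_cast; field_simp; ring
    · rw [foldM, e₂]; push_cast; field_simp; ring
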